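/- arXiv:2311.18301 — 6 statements merged into one kernel-verified Lean document; each statement's English description precedes it below -/
import Mathlib

section
/- If a finite simple graph H contains a cycle, then for every integer r ≥ e(H), H is r-rainbow uncommon; that is, limsup_{n→∞} (max over r-colorings φ of E(K_n) of the number of rainbow copies of H under φ) / n^{v(H)} > (r)_{e(H)} / (r^{e(H)} · |Aut(H)|). -/
open Finset

/-- The edge set of the complete graph `K_n` on vertex set `Fin n`,
encoded as ordered pairs `(u, v)` with `u < v`. -/
abbrev KEdge (n : ℕ) : Type := {q : Fin n × Fin n // q.1 < q.2}

/-- The number of rainbow copies of `H` in `K_n` under the edge coloring `φ`: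
the number of subgraphs of `K_n` that are isomorphic to `H` and all of whose
edges receive pairwise distinct colors under `φ`. -/
noncomputable def rainbowCount {p : ℕ} (H : SimpleGraph (Fin p)) {n r : ℕ}
    (φ : KEdge n → Fin r) : ℕ :=
  Nat.card {S : (⊤ : SimpleGraph (Fin n)).Subgraph //
    Nonempty (H ≃g S.coe) ∧ Set.InjOn φ {q : KEdge n | S.Adj q.val.1 q.val.2}}

/-- Marginalization of a product weight along an injective change of coordinates. -/
theorem sum_prod_mul_comp {X K E : Type*} [Fintype X] [DecidableEq X] [Fintype K]
    [DecidableEq K] [Fintype E] [DecidableEq E] (Q : X → K → ℝ) (hQ : ∀ x, ∑ i, Q x i = 1)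
    {m : E → X} (hm : Function.Injective m) (g : (E → K) → ℝ) :
    ∑ ψ : X → K, (∏ x, Q x (ψ x)) * g (ψ ∘ m) = ∑ c : E → K, (∏ e, Q (m e) (c e)) * g c := by
  rw [← Finset.sum_fiberwise univ (fun ψ : X → K => ψ ∘ m)]
  refine Finset.sum_congr rfl fun c _ => ?_
  have h1 : ∑ ψ : X → K with ψ ∘ m = c, (∏ x, Q x (ψ x)) * g (ψ ∘ m) =
      (∑ ψ : X → K with ψ ∘ m = c, ∏ x, Q x (ψ x)) * g c := by
    rw [Finset.sum_mul]
    refine Finset.sum_congr rfl fun ψ hψ => ?_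
    rw [(Finset.mem_filter.1 hψ).2]
  rw [h1]
  congr 1
  have h2 : (univ.filter fun ψ : X → K => ψ ∘ m = c) =
      Fintype.piFinset fun x => univ.filter fun i => ∀ e, m e = x → i = c e := by
    ext ψ
    simp only [mem_filter, mem_univ, true_and, Fintype.mem_piFinset]
    constructor
    · rintro rfl x e rfl
      rfl
    · intro h
      funext e
      exact h _ e rfl
  rw [h2, ← Finset.prod_univ_sum]
  refine (Fintype.prod_of_injective m hm _ _ ?_ ?_).symm
  · intro x hx
    rw [← hQ x]
    refine Finset.sum_congr ?_ fun _ _ => rfl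
    ext i
    simp only [mem_filter, mem_univ, true_and, iff_true]
    intro e he
    exact absurd ⟨e, he⟩ hx
  · intro e
    have : (univ.filter fun i => ∀ e', m e' = m e → i = c e') = {c e} := by
      ext i
      simp only [mem_filter, mem_univ, true_and, mem_singleton]
      exact ⟨fun h => h e rfl, fun h e' he' => by rw [hm he', h]⟩
    rw [this, Finset.sum_singleton]

/-- The product of the signs of the two ends of an edge. -/
def edgeSign {V : Type*} (s : V → ℤˣ) (e : Sym2 V) : ℤˣ := (e.map s).mul

theorem edgeSign_mk {V : Type*} (s : V → ℤˣ) (x y : V) : edgeSign s s(x, y) = s x * s y := rfl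

theorem edgeSign_map {V W : Type*} (f : V → W) (s : W → ℤˣ) (e : Sym2 V) :
    edgeSign s (e.map f) = edgeSign (s ∘ f) e := by
  rw [edgeSign, edgeSign, Sym2.map_map]

theorem edgeSign_mul {V : Type*} (s t : V → ℤˣ) (e : Sym2 V) :
    edgeSign (s * t) e = edgeSign s e * edgeSign t e := by
  induction e with
  | _ x y => simp only [edgeSign_mk, Pi.mul_apply, mul_mul_mul_comm]

/-- The probability that an edge `e` receives color `i`, given vertex signs `s`. -/
noncomputable def colorWeight {V : Type*} {r : ℕ} (a : Fin r → ℝ) (s : V → ℤˣ) (e : Sym2 V)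
    (i : Fin r) : ℝ :=
  1 / r + a i * ((edgeSign s e : ℤ) : ℝ)

theorem sum_colorWeight {V : Type*} {r : ℕ} (hr : 0 < r) {a : Fin r → ℝ} (ha : ∑ i, a i = 0)
    (s : V → ℤˣ) (e : Sym2 V) : ∑ i, colorWeight a s e i = 1 := by
  simp only [colorWeight, Finset.sum_add_distrib, ← Finset.sum_mul, ha]
  simp
  field_simp

theorem colorWeight_nonneg {V : Type*} {r : ℕ} {a : Fin r → ℝ} (ha : ∀ i, |a i| ≤ 1 / r)
    (s : V → ℤˣ) (e : Sym2 V) (i : Fin r) : 0 ≤ colorWeight a s e i := by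
  have := abs_le.1 (ha i)
  rcases Int.units_eq_one_or (edgeSign s e) with h | h <;> simp only [colorWeight, h] <;>
    push_cast <;> linarith

/-- The probability that a labelled copy of `H` is rainbow when vertices receive uniformly random
signs and edges receive random colors with probabilities `colorWeight`. -/
noncomputable def rainbowDensity {p r : ℕ} (H : SimpleGraph (Fin p)) [DecidableRel H.Adj]
    (a : Fin r → ℝ) : ℝ :=
  ∑ s : Fin p → ℤˣ, (∏ _v : Fin p, (1 / 2 : ℝ)) *
    ∑ c : H.edgeSet → Fin r, (∏ e, colorWeight a s e.1 (c e)) *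
      if Function.Injective c then 1 else 0

theorem descFactorial_mul_rainbowDensity_le {p r : ℕ} (H : SimpleGraph (Fin p))
    [DecidableRel H.Adj] (hr : 0 < r) {a : Fin r → ℝ} (ha0 : ∑ i, a i = 0)
    (ha : ∀ i, |a i| ≤ 1 / r) (n : ℕ) (B : ℝ)
    (hB : ∀ ψ : Sym2 (Fin n) → Fin r, (∑ f : Fin p ↪ Fin n,
      if Function.Injective (ψ ∘ fun e : H.edgeSet => e.1.map f) then (1 : ℝ) else 0) ≤ B) :
    n.descFactorial p * rainbowDensity H a ≤ B := by
  classical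
  have hhalf : ∀ v : Fin n, ∑ _x : ℤˣ, (1 / 2 : ℝ) = 1 := by
    intro v
    simp
  have key : ∀ f : Fin p ↪ Fin n, rainbowDensity H a =
      ∑ s : Fin n → ℤˣ, (∏ _v : Fin n, (1 / 2 : ℝ)) * ∑ ψ : Sym2 (Fin n) → Fin r,
        (∏ x, colorWeight a s x (ψ x)) *
          if Function.Injective (ψ ∘ fun e : H.edgeSet => e.1.map f) then 1 else 0 := by
    intro f
    have hm : Function.Injective fun e : H.edgeSet => e.1.map f :=
      (Sym2.map.injective f.injective).comp Subtype.val_injective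
    rw [rainbowDensity, ← sum_prod_mul_comp (fun _ _ => (1 / 2 : ℝ)) hhalf f.injective]
    refine Finset.sum_congr rfl fun s _ => ?_
    congr 1
    rw [sum_prod_mul_comp (colorWeight a s) (sum_colorWeight hr ha0 s) hm
      (fun c => if Function.Injective c then 1 else 0)]
    refine Finset.sum_congr rfl fun c _ => ?_
    simp only [colorWeight, edgeSign_map]
  have htot : ∀ s : Fin n → ℤˣ,
      ∑ ψ : Sym2 (Fin n) → Fin r, ∏ x, colorWeight a s x (ψ x) = 1 := by
    intro s
    rw [← Fintype.piFinset_univ, ← Finset.prod_univ_sum]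
    exact Finset.prod_eq_one fun x _ => sum_colorWeight hr ha0 s x
  have htot' : ∑ _s : Fin n → ℤˣ, ∏ _v : Fin n, (1 / 2 : ℝ) = 1 := by
    simp
  calc (n.descFactorial p : ℝ) * rainbowDensity H a
      = ∑ f : Fin p ↪ Fin n, rainbowDensity H a := by
        simp [Fintype.card_embedding_eq]
    _ = ∑ s : Fin n → ℤˣ, (∏ _v : Fin n, (1 / 2 : ℝ)) * ∑ ψ : Sym2 (Fin n) → Fin r,
        (∏ x, colorWeight a s x (ψ x)) * ∑ f : Fin p ↪ Fin n,
          if Function.Injective (ψ ∘ fun e : H.edgeSet => e.1.map f) then 1 else 0 := by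
        rw [Finset.sum_congr rfl fun f _ => key f, Finset.sum_comm]
        refine Finset.sum_congr rfl fun s _ => ?_
        rw [← Finset.mul_sum, Finset.sum_comm]
        simp only [Finset.mul_sum]
    _ ≤ ∑ s : Fin n → ℤˣ, (∏ _v : Fin n, (1 / 2 : ℝ)) * ∑ ψ : Sym2 (Fin n) → Fin r,
        (∏ x, colorWeight a s x (ψ x)) * B := by
        gcongr with s _ ψ _
        · exact Finset.prod_nonneg fun x _ => colorWeight_nonneg ha s x _
        · exact hB ψ
    _ = B := by
        simp only [← Finset.sum_mul, htot, one_mul, htot']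

/-- A set of edges is balanced if every vertex signing gives it total sign `1`. Equivalently,
all degrees are even. -/
def IsBalanced {V : Type*} {E : Set (Sym2 V)} (F : Finset E) : Prop :=
  ∀ s : V → ℤˣ, ∏ e ∈ F, edgeSign s e.1 = 1

theorem sum_prod_edgeSign {p : ℕ} {E : Set (Sym2 (Fin p))} (F : Finset E)
    [Decidable (IsBalanced F)] :
    ∑ s : Fin p → ℤˣ, (∏ _v : Fin p, (1 / 2 : ℝ)) * ∏ e ∈ F, ((edgeSign s e.1 : ℤ) : ℝ) =
      if IsBalanced F then 1 else 0 := by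
  have hcast : ∀ s : Fin p → ℤˣ, ∏ e ∈ F, ((edgeSign s e.1 : ℤ) : ℝ) =
      (((∏ e ∈ F, edgeSign s e.1 : ℤˣ) : ℤ) : ℝ) := by
    intro s
    push_cast
    rfl
  split_ifs with h
  · simp [hcast, h _]
  · rw [IsBalanced, not_forall] at h
    obtain ⟨t, ht⟩ := h
    have ht' := (Int.units_eq_one_or _).resolve_left ht
    rw [← Finset.mul_sum, mul_eq_zero]
    right
    have h2 : ∑ s : Fin p → ℤˣ, ∏ e ∈ F, ((edgeSign s e.1 : ℤ) : ℝ) =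
        - ∑ s : Fin p → ℤˣ, ∏ e ∈ F, ((edgeSign s e.1 : ℤ) : ℝ) := by
      conv_lhs => rw [← Equiv.sum_comp (Equiv.mulRight t)]
      rw [← Finset.sum_neg_distrib]
      refine Finset.sum_congr rfl fun s _ => ?_
      rw [hcast, hcast]
      simp only [Equiv.coe_mulRight, edgeSign_mul, Finset.prod_mul_distrib, ht']
      simp
    linarith

theorem edgeSign_edges_prod {V : Type*} {G : SimpleGraph V} (s : V → ℤˣ) {u v : V}
    (w : G.Walk u v) : (w.edges.map (edgeSign s)).prod = s u * s v := by
  induction w with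
  | nil => simp
  | cons h w ih =>
    rw [SimpleGraph.Walk.edges_cons, List.map_cons, List.prod_cons, ih, edgeSign_mk, mul_assoc,
      ← mul_assoc (s _) (s _) (s _), Int.units_mul_self, one_mul]

theorem exists_isBalanced {V : Type*} (G : SimpleGraph V) (hG : ¬ G.IsAcyclic) :
    ∃ F : Finset G.edgeSet, F.Nonempty ∧ IsBalanced F := by
  classical
  simp only [SimpleGraph.IsAcyclic, not_forall, not_not] at hG
  obtain ⟨v, w, hw⟩ := hG
  have hmem : ∀ e ∈ w.edges.toFinset, e ∈ G.edgeSet := fun e he =>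
    w.edges_subset_edgeSet (List.mem_toFinset.1 he)
  refine ⟨w.edges.toFinset.subtype (· ∈ G.edgeSet), ?_, ?_⟩
  · obtain ⟨e, he⟩ : ∃ e, e ∈ w.edges := by
      apply List.exists_mem_of_ne_nil
      intro h
      have h3 := hw.three_le_length
      rw [← SimpleGraph.Walk.length_edges, h] at h3
      simp at h3
    have he' := List.mem_toFinset.2 he
    exact ⟨⟨e, hmem e he'⟩, Finset.mem_subtype.2 he'⟩
  · intro s
    rw [Finset.prod_subtype_of_mem (edgeSign s) hmem,
      List.prod_toFinset _ hw.isCircuit.isTrail.edges_nodup, edgeSign_edges_prod,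
      Int.units_mul_self]

theorem IsBalanced.three_le_card {V : Type*} {G : SimpleGraph V} {F : Finset G.edgeSet}
    (hF : IsBalanced F) (hne : F.Nonempty) : 3 ≤ F.card := by
  classical
  have hflip : ∀ x y z : V, edgeSign (Pi.mulSingle x (-1)) s(y, z) =
      (if y = x then -1 else 1) * if z = x then -1 else 1 := by
    intro x y z
    simp [edgeSign_mk, Pi.mulSingle_apply]
  have hcard := hne.card_pos
  by_contra! hlt
  obtain h | h : F.card = 1 ∨ F.card = 2 := by omega
  · obtain ⟨⟨e, he⟩, rfl⟩ := Finset.card_eq_one.1 h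
    induction e with
    | _ x y =>
      have hxy : x ≠ y := G.ne_of_adj he
      have := hF (Pi.mulSingle x (-1))
      simp [hflip, hxy.symm] at this
  · obtain ⟨⟨e, he⟩, ⟨e', he'⟩, hee, rfl⟩ := Finset.card_eq_two.1 h
    induction e with
    | _ x y =>
    induction e' with
    | _ z t =>
      have hxy : x ≠ y := G.ne_of_adj he
      have hzt : z ≠ t := G.ne_of_adj he'
      have hx := hF (Pi.mulSingle x (-1))
      have hy := hF (Pi.mulSingle y (-1))
      rw [Finset.prod_pair hee] at hx hy
      simp only [hflip, hxy, hxy.symm, if_true, if_false] at hx hy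
      simp only [ne_eq, Subtype.mk.injEq, Sym2.eq_iff] at hee
      by_cases h1 : z = x <;> by_cases h2 : t = x <;> by_cases h3 : z = y <;>
        by_cases h4 : t = y <;> simp_all

/-- A perturbation of the uniform color distribution supported on `g` colors, whose coordinates on
the support have positive product. -/
theorem exists_perturbation {g r : ℕ} (hg : 3 ≤ g) (hgr : g ≤ r) :
    ∃ a : Fin r → ℝ, ∑ i, a i = 0 ∧ (∀ i, |a i| ≤ 1 / r) ∧
      (∀ T : Finset (Fin r), g ≤ T.card → 0 ≤ ∏ i ∈ T, a i) ∧
      ∃ T : Finset (Fin r), T.card = g ∧ 0 < ∏ i ∈ T, a i := by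
  classical
  obtain ⟨k, rfl⟩ := Nat.exists_eq_add_of_le' hg
  have hr : (0 : ℝ) < r := by exact_mod_cast (by omega : 0 < r)
  set b : ℕ → ℝ := fun i => 1 / ((r : ℝ) * ((k : ℝ) + 3)) *
    (if i < 2 then -((k : ℝ) + 1) else if i < k + 3 then 2 else 0) with hb
  have hk : (0 : ℝ) < 1 / (r * (k + 3)) := by positivity
  set T₀ : Finset (Fin r) := univ.map (Fin.castLEEmb hgr) with hT₀
  have hcard : T₀.card = k + 3 := by simp [hT₀]
  have hout : ∀ i ∉ T₀, b i = 0 := by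
    intro i hi
    have h1 : ¬ (i : ℕ) < k + 3 := fun h => hi (by
      rw [hT₀, Finset.mem_map]
      exact ⟨⟨i, h⟩, Finset.mem_univ _, rfl⟩)
    have h2 : ¬ (i : ℕ) < 2 := by omega
    simp only [hb, if_neg h1, if_neg h2, mul_zero]
  have h0 : b (Fin.castLEEmb hgr 0 : Fin r) = 1 / (r * (k + 3)) * -(k + 1) := by simp [hb]
  have h1 : b (Fin.castLEEmb hgr (Fin.succ 0) : Fin r) = 1 / (r * (k + 3)) * -(k + 1) := by
    simp [hb]
  have h2 : ∀ i : Fin (k + 1), b (Fin.castLEEmb hgr i.succ.succ : Fin r) =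
      1 / (r * (k + 3)) * 2 := by
    intro i
    have h3 : ¬ (i : ℕ) + 1 + 1 < 2 := by omega
    have h4 : (i : ℕ) + 1 + 1 < k + 3 := by omega
    simp only [hb, Fin.coe_castLEEmb, Fin.val_castLE, Fin.val_succ, if_neg h3, if_pos h4]
  have hpos : 0 < ∏ i ∈ T₀, b i := by
    rw [hT₀, Finset.prod_map, Fin.prod_univ_succ, Fin.prod_univ_succ, h0, h1,
      Finset.prod_congr rfl fun i _ => h2 i, ← mul_assoc, mul_mul_mul_comm]
    have : (0 : ℝ) < k + 1 := by positivity
    have : (0 : ℝ) < -(k + 1) * -(k + 1) := by nlinarith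
    positivity
  refine ⟨fun i => b i, ?_, ?_, ?_, T₀, hcard, hpos⟩
  · rw [← Finset.sum_subset (Finset.subset_univ T₀) fun i _ hi => hout i hi, hT₀,
      Finset.sum_map, Fin.sum_univ_succ, Fin.sum_univ_succ, h0, h1,
      Finset.sum_congr rfl fun i _ => h2 i, Finset.sum_const, Finset.card_univ,
      Fintype.card_fin, nsmul_eq_mul]
    push_cast
    ring
  · intro i
    have hle : |if (i : ℕ) < 2 then -((k : ℝ) + 1) else if (i : ℕ) < k + 3 then 2 else 0| ≤
        k + 3 := by
      have : (0 : ℝ) ≤ k := by positivity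
      split_ifs <;> rw [abs_le] <;> constructor <;> linarith
    rw [hb, abs_mul, abs_of_pos hk]
    calc _ ≤ 1 / ((r : ℝ) * (k + 3)) * (k + 3) := by gcongr
      _ = 1 / r := by field_simp
  · intro T hT
    by_cases hTT : T ⊆ T₀
    · rw [Finset.eq_of_subset_of_card_le hTT (by omega)]
      exact hpos.le
    · obtain ⟨i, hi, hi'⟩ := Finset.not_subset.1 hTT
      exact (Finset.prod_eq_zero hi (hout i hi')).ge

theorem sum_prod_colorWeight {p r : ℕ} {E : Set (Sym2 (Fin p))} [Fintype E] (a : Fin r → ℝ)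
    (c : E → Fin r) [DecidableEq E] [DecidablePred (IsBalanced (E := E))] :
    ∑ s : Fin p → ℤˣ, (∏ _v : Fin p, (1 / 2 : ℝ)) * ∏ e, colorWeight a s e.1 (c e) =
      ∑ F : Finset E, if IsBalanced F then (∏ e ∈ F, a (c e)) * (1 / r) ^ Fᶜ.card else 0 := by
  simp only [colorWeight, add_comm (1 / (r : ℝ)), Fintype.prod_add, Finset.mul_sum]
  rw [Finset.sum_comm]
  refine Finset.sum_congr rfl fun F _ => ?_
  have h := sum_prod_edgeSign F
  calc _ = ((∏ e ∈ F, a (c e)) * (1 / r) ^ Fᶜ.card) * ∑ s : Fin p → ℤˣ,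
        (∏ _v : Fin p, (1 / 2 : ℝ)) * ∏ e ∈ F, ((edgeSign s e.1 : ℤ) : ℝ) := by
        rw [Finset.mul_sum]
        refine Finset.sum_congr rfl fun s _ => ?_
        rw [Finset.prod_mul_distrib, Finset.prod_const (1 / (r : ℝ))]
        ring
    _ = _ := by rw [h, mul_ite, mul_one, mul_zero]

theorem exists_lt_rainbowDensity {p r : ℕ} (H : SimpleGraph (Fin p)) [DecidableRel H.Adj]
    (hH : ¬ H.IsAcyclic) (hr : H.edgeFinset.card ≤ r) :
    ∃ a : Fin r → ℝ, ∑ i, a i = 0 ∧ (∀ i, |a i| ≤ 1 / r) ∧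
      (r.descFactorial H.edgeFinset.card : ℝ) / (r : ℝ) ^ H.edgeFinset.card <
        rainbowDensity H a := by
  classical
  have hE : Fintype.card H.edgeSet = H.edgeFinset.card := (Set.toFinset_card _).symm
  obtain ⟨F₁, hF₁⟩ := exists_isBalanced H hH
  obtain ⟨F₀, hF₀, hmin⟩ := Finset.exists_min_image
    (univ.filter fun F : Finset H.edgeSet => F.Nonempty ∧ IsBalanced F) Finset.card
    ⟨F₁, by simpa using hF₁⟩
  simp only [mem_filter, mem_univ, true_and] at hF₀ hmin
  have h3 := hF₀.2.three_le_card hF₀.1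
  have hle : F₀.card ≤ Fintype.card H.edgeSet := Finset.card_le_univ _
  obtain ⟨a, ha0, ha, hnonneg, T, hT, hTpos⟩ := exists_perturbation (r := r) h3 (by omega)
  refine ⟨a, ha0, ha, ?_⟩
  have hr0 : (0 : ℝ) < r := by exact_mod_cast (by omega : 0 < r)
  have hterm : ∀ c : H.edgeSet → Fin r, Function.Injective c → ∀ F : Finset H.edgeSet,
      0 ≤ if IsBalanced F then (∏ e ∈ F, a (c e)) * (1 / (r : ℝ)) ^ Fᶜ.card else 0 := by
    intro c hc F
    split_ifs with hF
    · refine mul_nonneg ?_ (by positivity)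
      rcases F.eq_empty_or_nonempty with rfl | hne
      · simp
      · rw [← Finset.prod_image (f := a) (g := c) (s := F) fun x _ y _ h => hc h]
        apply hnonneg
        rw [Finset.card_image_of_injective _ hc]
        exact hmin F ⟨hne, hF⟩
    · exact le_rfl
  have hempty : ∀ c : H.edgeSet → Fin r, (if IsBalanced (∅ : Finset H.edgeSet) then
      (∏ e ∈ (∅ : Finset H.edgeSet), a (c e)) * (1 / (r : ℝ)) ^ (∅ᶜ : Finset H.edgeSet).card
        else 0) = (1 / (r : ℝ)) ^ H.edgeFinset.card := by
    intro c
    have : IsBalanced (∅ : Finset H.edgeSet) := fun s => Finset.prod_empty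
    rw [if_pos this, Finset.prod_empty, one_mul, Finset.compl_empty,
      Finset.card_univ, hE]
  have hsum : rainbowDensity H a = ∑ c : H.edgeSet ↪ Fin r, ∑ F : Finset H.edgeSet,
      if IsBalanced F then (∏ e ∈ F, a (c e)) * (1 / (r : ℝ)) ^ Fᶜ.card else 0 := by
    rw [rainbowDensity]
    simp only [Finset.mul_sum]
    rw [Finset.sum_comm]
    calc _ = ∑ c : H.edgeSet → Fin r, if Function.Injective c then
          (∑ s : Fin p → ℤˣ, (∏ _v : Fin p, (1 / 2 : ℝ)) * ∏ e, colorWeight a s e.1 (c e)) else 0 :=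
          Finset.sum_congr rfl fun c _ => by split_ifs <;> simp
      _ = _ := by
          simp only [sum_prod_colorWeight]
          rw [← Finset.sum_filter,
            ← Equiv.sum_comp (Equiv.subtypeInjectiveEquivEmbedding H.edgeSet (Fin r))]
          exact Finset.sum_subtype _ (by simp) _
  obtain ⟨c₀, hc₀⟩ : ∃ c : H.edgeSet ↪ Fin r, F₀.map c = T := by
    obtain ⟨c⟩ : Nonempty (H.edgeSet ↪ Fin r) :=
      Function.Embedding.nonempty_of_card_le (by rw [Fintype.card_fin]; omega)
    obtain ⟨σ, hσ⟩ : ∃ σ : Equiv.Perm (Fin r), (F₀.map c).map σ.toEmbedding = T := by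
      let e : {i // i ∈ F₀.map c} ≃ {i // i ∈ T} :=
        Finset.equivOfCardEq (by rw [Finset.card_map, hT])
      refine ⟨e.extendSubtype, Finset.eq_of_subset_of_card_le (fun i hi => ?_) ?_⟩
      · obtain ⟨j, hj, rfl⟩ := Finset.mem_map.1 hi
        exact e.extendSubtype_mem j hj
      · rw [Finset.card_map, Finset.card_map, hT]
    exact ⟨c.trans σ.toEmbedding, by rw [← Finset.map_map, hσ]⟩
  have hconst : (r.descFactorial H.edgeFinset.card : ℝ) / (r : ℝ) ^ H.edgeFinset.card =
      ∑ _c : H.edgeSet ↪ Fin r, (1 / (r : ℝ)) ^ H.edgeFinset.card := by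
    rw [Finset.sum_const, Finset.card_univ, Fintype.card_embedding_eq, Fintype.card_fin, hE,
      nsmul_eq_mul, one_div, inv_pow, div_eq_mul_inv]
  rw [hsum, hconst]
  refine Finset.sum_lt_sum (fun c _ => ?_) ⟨c₀, Finset.mem_univ _, ?_⟩
  · rw [← hempty c]
    exact Finset.single_le_sum (fun F _ => hterm c c.injective F) (Finset.mem_univ ∅)
  · rw [← hempty c₀]
    refine Finset.single_lt_sum hF₀.1.ne_empty (Finset.mem_univ ∅) (Finset.mem_univ F₀) ?_
      fun F _ _ => hterm c₀ c₀.injective F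
    rw [if_pos hF₀.2]
    refine mul_pos ?_ (by positivity)
    rw [← Finset.prod_map F₀ c₀ a, hc₀]
    exact hTpos

/-- The edge coloring of `K_n` induced by a coloring of all unordered pairs. -/
def restrictColoring {n r : ℕ} (ψ : Sym2 (Fin n) → Fin r) (q : KEdge n) : Fin r :=
  ψ s(q.1.1, q.1.2)

theorem KEdge.ext_of_sym2 {n : ℕ} {q q' : KEdge n} (h : s(q.1.1, q.1.2) = s(q'.1.1, q'.1.2)) :
    q = q' := by
  rcases Sym2.eq_iff.1 h with ⟨h1, h2⟩ | ⟨h1, h2⟩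
  · exact Subtype.ext (Prod.ext h1 h2)
  · have := q.2
    rw [h1, h2] at this
    exact absurd q'.2 this.asymm

theorem card_rainbow_embedding_le {p n r : ℕ} (H : SimpleGraph (Fin p))
    (ψ : Sym2 (Fin n) → Fin r) :
    Nat.card {f : Fin p ↪ Fin n //
      Function.Injective (ψ ∘ fun e : H.edgeSet => e.1.map f)} ≤
      rainbowCount H (restrictColoring ψ) * Nat.card (H ≃g H) := by
  classical
  rw [rainbowCount, ← Nat.card_prod]
  let toCopy (f : Fin p ↪ Fin n) : SimpleGraph.Copy H (⊤ : SimpleGraph (Fin n)) :=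
    ⟨⟨f, fun h => f.injective.ne h.ne⟩, f.injective⟩
  have hgood : ∀ f : {f : Fin p ↪ Fin n //
      Function.Injective (ψ ∘ fun e : H.edgeSet => e.1.map f)},
      Nonempty (H ≃g (toCopy f.1).toSubgraph.coe) ∧ Set.InjOn (restrictColoring ψ)
        {q : KEdge n | (toCopy f.1).toSubgraph.Adj q.val.1 q.val.2} := by
    rintro ⟨f, hf⟩
    refine ⟨⟨(toCopy f).isoToSubgraph⟩, ?_⟩
    have hlift : ∀ q : KEdge n, (toCopy f).toSubgraph.Adj q.val.1 q.val.2 →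
        ∃ e : H.edgeSet, e.1.map f = s(q.1.1, q.1.2) := by
      intro q hq
      obtain ⟨x, y, hxy, hx, hy⟩ := hq
      exact ⟨⟨s(x, y), hxy⟩, by rw [← hx, ← hy]; rfl⟩
    intro q hq q' hq' hqq
    obtain ⟨e, he⟩ := hlift q hq
    obtain ⟨e', he'⟩ := hlift q' hq'
    have : e = e' := hf (by
      simp only [Function.comp_apply, he, he']
      exact hqq)
    exact KEdge.ext_of_sym2 (by rw [← he, ← he', this])
  let good := {S : (⊤ : SimpleGraph (Fin n)).Subgraph // Nonempty (H ≃g S.coe) ∧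
    Set.InjOn (restrictColoring ψ) {q : KEdge n | S.Adj q.val.1 q.val.2}}
  let iso (S : good) : H ≃g S.1.coe := S.2.1.some
  let code (f : {f : Fin p ↪ Fin n //
      Function.Injective (ψ ∘ fun e : H.edgeSet => e.1.map f)}) : good × (H ≃g H) :=
    (⟨(toCopy f.1).toSubgraph, hgood f⟩,
      (toCopy f.1).isoToSubgraph.trans (iso ⟨(toCopy f.1).toSubgraph, hgood f⟩).symm)
  let decode (x : good × (H ≃g H)) : Fin p → Fin n := fun v => (iso x.1 (x.2 v)).1
  have hdecode : ∀ f, decode (code f) = f.1 := by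
    intro f
    funext v
    simp only [decode, code, RelIso.trans_apply, RelIso.apply_symm_apply]
    rfl
  have : Finite (H ≃g H) := Finite.of_injective _ (DFunLike.coe_injective (F := H ≃g H))
  have : Finite (good × (H ≃g H)) := inferInstance
  refine @Nat.card_le_card_of_injective _ _ this code fun f f' h =>
    Subtype.ext (DFunLike.coe_injective ?_)
  rw [← hdecode f, ← hdecode f', h]

theorem rainbowCount_le {p n r : ℕ} (H : SimpleGraph (Fin p)) (φ : KEdge n → Fin r) :
    rainbowCount H φ ≤ n ^ p := by
  classical
  have hsurj : ∀ S : {S : (⊤ : SimpleGraph (Fin n)).Subgraph //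
      Nonempty (H ≃g S.coe) ∧ Set.InjOn φ {q : KEdge n | S.Adj q.val.1 q.val.2}},
      ∃ f : SimpleGraph.Copy H (⊤ : SimpleGraph (Fin n)), f.toSubgraph = S.1 := fun S => by
    obtain ⟨f, -, hf⟩ := SimpleGraph.Copy.toSubgraph_surjOn S.2.1
    exact ⟨f, hf⟩
  choose F hF using hsurj
  calc rainbowCount H φ ≤ Nat.card (Fin p → Fin n) :=
        Nat.card_le_card_of_injective (fun S => (F S : Fin p → Fin n)) fun S S' h =>
          Subtype.ext (by rw [← hF S, ← hF S', DFunLike.coe_injective h])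
    _ = n ^ p := by simp

/-- **If a graph contains a cycle, it is `r`-rainbow uncommon for every `r ≥ e(H)`**:
the limsup over `n` of (the maximum over `r`-colorings `φ` of `E(K_n)` of the number of
rainbow copies of `H` under `φ`) divided by `n ^ v(H)` strictly exceeds
`(r)_{e(H)} / (r ^ e(H) · |Aut(H)|)`. -/
theorem cyclic_graph_rainbow_uncommon {p : ℕ} (H : SimpleGraph (Fin p))
    [DecidableRel H.Adj] (hH : ¬ H.IsAcyclic) (r : ℕ) (hr : H.edgeFinset.card ≤ r) :
    (r.descFactorial H.edgeFinset.card : ℝ) /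
        ((r : ℝ) ^ H.edgeFinset.card * (Nat.card (H ≃g H) : ℝ)) <
      Filter.atTop.limsup (fun n : ℕ =>
        (⨆ φ : KEdge n → Fin r, (rainbowCount H φ : ℝ)) / (n : ℝ) ^ p) := by
  classical
  obtain ⟨a, ha0, ha, hlt⟩ := exists_lt_rainbowDensity H hH hr
  have hr0 : 0 < r := by
    obtain ⟨F, hF, hbal⟩ := exists_isBalanced H hH
    have h1 := hbal.three_le_card hF
    have h2 : F.card ≤ Fintype.card H.edgeSet := Finset.card_le_univ _
    have h3 : Fintype.card H.edgeSet = H.edgeFinset.card := (Set.toFinset_card _).symm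
    omega
  have hAut : (0 : ℝ) < Nat.card (H ≃g H) := by
    have : Finite (H ≃g H) := Finite.of_injective _ (DFunLike.coe_injective (F := H ≃g H))
    exact_mod_cast Nat.card_pos
  have hbdd : ∀ n : ℕ, BddAbove (Set.range fun φ : KEdge n → Fin r => (rainbowCount H φ : ℝ)) :=
    fun n => Set.finite_range _ |>.bddAbove
  have hlower : ∀ n : ℕ, n.descFactorial p * rainbowDensity H a ≤
      (⨆ φ : KEdge n → Fin r, (rainbowCount H φ : ℝ)) * Nat.card (H ≃g H) := by
    intro n
    refine descFactorial_mul_rainbowDensity_le H hr0 ha0 ha n _ fun ψ => ?_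
    have h1 := card_rainbow_embedding_le H ψ
    rw [Nat.card_eq_fintype_card, Fintype.card_subtype] at h1
    rw [Finset.sum_boole]
    calc _ ≤ ((rainbowCount H (restrictColoring ψ) * Nat.card (H ≃g H) : ℕ) : ℝ) := by
          exact_mod_cast h1
      _ ≤ _ := by
          rw [Nat.cast_mul]
          gcongr
          exact le_ciSup (hbdd n) (restrictColoring ψ)
  have hlim : Filter.Tendsto (fun n : ℕ => ((n.descFactorial p : ℝ) / (n : ℝ) ^ p) *
      (rainbowDensity H a / Nat.card (H ≃g H))) Filter.atTop
      (nhds (1 * (rainbowDensity H a / Nat.card (H ≃g H)))) := by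
    refine Filter.Tendsto.mul_const _ ?_
    refine (Asymptotics.isEquivalent_iff_tendsto_one ?_).1 (isEquivalent_descFactorial p)
    filter_upwards [Filter.eventually_gt_atTop 0] with n hn
    positivity
  have hlt' : (r.descFactorial H.edgeFinset.card : ℝ) /
      ((r : ℝ) ^ H.edgeFinset.card * (Nat.card (H ≃g H) : ℝ)) <
      1 * (rainbowDensity H a / Nat.card (H ≃g H)) := by
    rw [one_mul, ← div_div]
    gcongr
  obtain ⟨b, hb1, hb2⟩ := exists_between hlt'
  refine hb1.trans_le (Filter.le_limsup_of_frequently_le ?_ ?_)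
  · refine Filter.Eventually.frequently ?_
    filter_upwards [hlim.eventually (lt_mem_nhds hb2)] with n hn
    refine hn.le.trans ?_
    rw [div_mul_div_comm, mul_comm ((n : ℝ) ^ p), ← div_div]
    gcongr
    rw [div_le_iff₀ hAut]
    exact hlower n
  · refine ⟨1, Filter.eventually_map.2 (Filter.Eventually.of_forall fun n => ?_)⟩
    refine div_le_one_of_le₀ ?_ (by positivity)
    refine Real.iSup_le (fun φ => ?_) (by positivity)
    exact_mod_cast rainbowCount_le H φ
end

section
/- For all integers r ≥ s ≥ 3, there exists an integer k with 1 ≤ k ≤ r−1 such that F(r,s,k) := Σ_{i=0}^{s} (−1)^i · C(k,i) · C(r−k, s−i) · k^{s−i} · (r−k)^i > 0. -/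
open Finset

/-- `F(r, s, k) = Σ_{i=0}^{s} (−1)^i C(k,i) C(r−k, s−i) k^{s−i} (r−k)^i`. -/
def F (r s k : ℕ) : ℤ :=
  ∑ i ∈ Finset.range (s + 1),
    (-1 : ℤ) ^ i * (k.choose i : ℤ) * ((r - k).choose (s - i) : ℤ) *
      (k : ℤ) ^ (s - i) * ((r - k : ℕ) : ℤ) ^ i

/-- For `k = 2` only the terms `i = 0, 1, 2` of `F` survive. -/
lemma F_two (m t : ℕ) :
    F (m + 2) (t + 2) 2 = 2 ^ t * (4 * (m.choose (t + 2) : ℤ) - 4 * m * m.choose (t + 1) +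
      (m : ℤ) ^ 2 * m.choose t) := by
  have h : ∀ i, Nat.choose 2 (i + 1 + 1 + 1) = 0 := fun i =>
    Nat.choose_eq_zero_of_lt (by omega)
  simp only [F, Finset.sum_range_succ', h, Nat.add_sub_cancel]
  simp
  ring

/-- With one part equal to `r - k = 1` only the terms `i = s - 1, s` of `F` survive. -/
lemma F_three_pred (n : ℕ) :
    F (n + 1) 3 n = n * (n.choose 2 : ℤ) - n.choose 3 := by
  simp [F, Finset.sum_range_succ, Nat.choose_eq_zero_of_lt]
  ring

lemma cast_choose_succ_mul (m t : ℕ) :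
    (m.choose (t + 1) : ℤ) * (t + 1) = m.choose t * ((m : ℤ) - t) := by
  rcases le_or_gt t m with h | h
  · have := Nat.choose_succ_right_eq m t
    zify [h] at this
    exact this
  · simp [Nat.choose_eq_zero_of_lt h, Nat.choose_eq_zero_of_lt (h.trans t.lt_succ_self)]

lemma F_two_pos (m t : ℕ) (ht : 2 ≤ t) (htm : t ≤ m) : 0 < F (m + 2) (t + 2) 2 := by
  rw [F_two]
  have h₁ := cast_choose_succ_mul m t
  have h₂ := cast_choose_succ_mul m (t + 1)
  push_cast at h₂
  have hc : (0 : ℤ) < m.choose t := mod_cast Nat.choose_pos htm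
  have ht' : (0 : ℤ) ≤ t - 2 := by exact sub_nonneg.mpr (mod_cast ht)
  have key : (4 * (m.choose (t + 2) : ℤ) - 4 * m * m.choose (t + 1) +
      (m : ℤ) ^ 2 * m.choose t) * ((t + 1) * (t + 2)) =
      m.choose t * ((t + 1) * ((m : ℤ) ^ 2 * (t - 2) + 4 * m * ((t - 2) + 1) + 4 * t)) := by
    linear_combination 4 * ((t : ℤ) + 1) * h₂ +
      (4 * ((m : ℤ) - t - 1) - 4 * m * (t + 2)) * h₁
  have ht₀ : (0 : ℤ) < t := by linarith
  have hpos : (0 : ℤ) <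
      m.choose t * ((t + 1) * ((m : ℤ) ^ 2 * (t - 2) + 4 * m * ((t - 2) + 1) + 4 * t)) := by
    positivity
  rw [← key] at hpos
  exact mul_pos (by positivity) (pos_of_mul_pos_left hpos (by positivity))

lemma F_three_pred_pos (n : ℕ) (hn : 2 ≤ n) : 0 < F (n + 1) 3 n := by
  rw [F_three_pred]
  have h := cast_choose_succ_mul n 2
  have hc : (0 : ℤ) < n.choose 2 := mod_cast Nat.choose_pos hn
  have hn' : (2 : ℤ) ≤ n := mod_cast hn
  norm_num at h
  nlinarith

/-- **For all `r ≥ s ≥ 3` there is `1 ≤ k ≤ r − 1` with `F(r, s, k) > 0`.** -/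
theorem exists_F_pos (r s : ℕ) (hs : 3 ≤ s) (hsr : s ≤ r) :
    ∃ k : ℕ, 1 ≤ k ∧ k ≤ r - 1 ∧ 0 < F r s k := by
  obtain rfl | hs := hs.eq_or_lt
  · obtain ⟨n, rfl⟩ : ∃ n, r = n + 1 := ⟨r - 1, by omega⟩
    exact ⟨n, by omega, by omega, F_three_pred_pos n (by omega)⟩
  · obtain ⟨m, rfl⟩ : ∃ m, r = m + 2 := ⟨r - 2, by omega⟩
    obtain ⟨t, rfl⟩ : ∃ t, s = t + 2 := ⟨s - 2, by omega⟩
    exact ⟨2, by omega, by omega, F_two_pos m t (by omega) (by omega)⟩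
end

section
/- For all integers r ≥ s ≥ 4, F(r,s,2) = 2^s · C(r−2, s−2) · ((s+ℓ)/(4s)) · ((s−4)ℓ + (s−2)²) where ℓ = r−s; in particular F(r,s,2) > 0. -/
open Finset

/-- Only the terms `i = 0, 1, 2` contribute to `F r s 2`. -/
lemma F_two_expand (n t : ℕ) :
    F (n + 2) (t + 2) 2 = (n.choose (t + 2) : ℤ) * 2 ^ (t + 2)
      - 2 * n.choose (t + 1) * 2 ^ (t + 1) * n + n.choose t * 2 ^ t * (n : ℤ) ^ 2 := by
  have h : ∀ i ∈ Finset.range (t + 2 + 1), i ∉ Finset.range 3 →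
      (-1 : ℤ) ^ i * (Nat.choose 2 i : ℤ) * ((n + 2 - 2).choose (t + 2 - i) : ℤ) *
        ((2 : ℕ) : ℤ) ^ (t + 2 - i) * ((n + 2 - 2 : ℕ) : ℤ) ^ i = 0 := by
    intro i _ hi
    rw [Nat.choose_eq_zero_of_lt (by rw [Finset.mem_range] at hi; omega : 2 < i)]
    simp
  rw [F, ← Finset.sum_subset (Finset.range_mono (by omega : 3 ≤ t + 2 + 1)) h]
  simp [Finset.sum_range_succ]
  ring

/-- The absorption identity `C(n, k+1) (k+1) = C(n, k) (n - k)` with subtraction in `ℝ`. -/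
lemma choose_succ_mul_cast (n k : ℕ) :
    (n.choose (k + 1) : ℝ) * (k + 1) = n.choose k * ((n : ℝ) - k) := by
  rcases le_or_gt k n with h | h
  · rw [← Nat.cast_sub h]
    exact_mod_cast Nat.choose_succ_right_eq n k
  · simp [Nat.choose_eq_zero_of_lt h, Nat.choose_eq_zero_of_lt (h.trans k.lt_succ_self)]

/-- **For `r ≥ s ≥ 4`, with `ℓ = r − s`,
`F(r,s,2) = 2^s C(r−2, s−2) ((s+ℓ)/(4s)) ((s−4)ℓ + (s−2)²) > 0`.** -/
theorem F_two_eq_and_pos (r s : ℕ) (hs : 4 ≤ s) (hsr : s ≤ r) :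
    (F r s 2 : ℝ) = 2 ^ s * ((r - 2).choose (s - 2) : ℝ) *
        (((s : ℝ) + ((r - s : ℕ) : ℝ)) / (4 * s)) *
        (((s : ℝ) - 4) * ((r - s : ℕ) : ℝ) + ((s : ℝ) - 2) ^ 2) ∧
      0 < F r s 2 := by
  obtain ⟨l, rfl⟩ := Nat.exists_eq_add_of_le hsr
  obtain ⟨t, rfl⟩ := Nat.exists_eq_add_of_le' (by omega : 2 ≤ s)
  have ht : (2 : ℝ) ≤ t := by exact_mod_cast (by omega : 2 ≤ t)
  have key : (F (t + 2 + l) (t + 2) 2 : ℝ) =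
      2 ^ (t + 2) * ((t + 2 + l - 2).choose (t + 2 - 2) : ℝ) *
        ((((t + 2 : ℕ) : ℝ) + ((t + 2 + l - (t + 2) : ℕ) : ℝ)) / (4 * (t + 2 : ℕ))) *
        ((((t + 2 : ℕ) : ℝ) - 4) * ((t + 2 + l - (t + 2) : ℕ) : ℝ) +
          (((t + 2 : ℕ) : ℝ) - 2) ^ 2) := by
    rw [show t + 2 + l = t + l + 2 by omega, F_two_expand, show t + l + 2 - 2 = t + l by omega,
      show t + l + 2 - (t + 2) = l by omega, show t + 2 - 2 = t by omega]
    have h1 := choose_succ_mul_cast (t + l) t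
    have h2 := choose_succ_mul_cast (t + l) (t + 1)
    rw [← eq_div_iff (by positivity)] at h1
    rw [← eq_div_iff (by positivity)] at h2
    push_cast at h1 h2 ⊢
    rw [h2, h1]
    field_simp
    ring
  refine ⟨key, ?_⟩
  have hpos : (0 : ℝ) < F (t + 2 + l) (t + 2) 2 := by
    rw [key]
    have hc : (0 : ℝ) < ((t + 2 + l - 2).choose (t + 2 - 2) : ℝ) := by
      exact_mod_cast Nat.choose_pos (by omega)
    have hq : (0 : ℝ) < (((t + 2 : ℕ) : ℝ) - 4) * ((t + 2 + l - (t + 2) : ℕ) : ℝ) +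
        (((t + 2 : ℕ) : ℝ) - 2) ^ 2 := by
      have h4 : (0 : ℝ) ≤ ((t + 2 : ℕ) : ℝ) - 4 := by push_cast; linarith
      have h2 : (0 : ℝ) < ((t + 2 : ℕ) : ℝ) - 2 := by linarith
      positivity
    positivity
  exact_mod_cast hpos
end

section
/- Let H be a finite simple graph with v(H) ≥ 2 vertices, let r, m ≥ 2 be integers, and suppose there is an r-coloring of E(K_m) with at least ℓ rainbow copies of H. Then for every positive integer d there exists an r-coloring of E(K_{m^d}) with at least ℓ · (m^{d·v(H)} − m^d)/(m^{v(H)} − m) rainbow copies of H. -/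
open Finset

namespace SimpleGraph

variable {α V W X κ : Type*} (H : SimpleGraph α)

/-- The copy of `H` in the complete graph on `V` placed by the injection `F`. -/
def copyOf (F : α ↪ V) : (⊤ : SimpleGraph V).Subgraph where
  verts := Set.range F
  Adj := Relation.Map H.Adj F F
  adj_sub := by
    rintro _ _ ⟨i, j, h, rfl, rfl⟩
    exact fun e => h.ne (F.injective e)
  edge_vert := by
    rintro _ _ ⟨i, j, h, rfl, rfl⟩
    exact ⟨i, rfl⟩
  symm := ⟨by
    rintro _ _ ⟨i, j, h, rfl, rfl⟩
    exact ⟨j, i, h.symm, rfl, rfl⟩⟩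

/-- The edges of the copy of `H` placed by `F` have pairwise distinct colors under `c`. -/
def IsRainbow (c : V → V → κ) (F : α ↪ V) : Prop :=
  ∀ i j k l, H.Adj i j → H.Adj k l → c (F i) (F j) = c (F k) (F l) → s(i, j) = s(k, l)

/-- The set of rainbow copies of `H` in the complete graph on `V` colored by `c`. -/
def rainbowCopies (c : V → V → κ) : Set (⊤ : SimpleGraph V).Subgraph :=
  {S | ∃ F : α ↪ V, H.copyOf F = S ∧ H.IsRainbow c F}

variable {H}

lemma copyOf_eq_of_comp_eq {F F' : α ↪ V} {G G' : α ↪ W} (π : V → W)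
    (h : H.copyOf F = H.copyOf F') (hG : ∀ i, π (F i) = G i) (hG' : ∀ i, π (F' i) = G' i) :
    H.copyOf G = H.copyOf G' := by
  have hv : Set.range F = Set.range F' := congrArg Subgraph.verts h
  have ha : Relation.Map H.Adj F F = Relation.Map H.Adj F' F' := congrArg Subgraph.Adj h
  have e : ⇑G = π ∘ F := funext fun i => (hG i).symm
  have e' : ⇑G' = π ∘ F' := funext fun i => (hG' i).symm
  apply Subgraph.ext
  · change Set.range G = Set.range G'
    rw [e, e', Set.range_comp, Set.range_comp, hv]
  · change Relation.Map H.Adj G G = Relation.Map H.Adj G' G'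
    rw [e, e', ← Relation.map_map, ← Relation.map_map, ha]

lemma mem_range_of_copyOf_eq {F F' : α ↪ V} (h : H.copyOf F = H.copyOf F') (i : α) :
    ∃ j, F' j = F i := by
  have hv : Set.range F = Set.range F' := congrArg Subgraph.verts h
  have hi : F i ∈ Set.range F' := by
    rw [← hv]
    exact Set.mem_range_self i
  exact hi

variable (H)

/-- The lexicographic product of two colorings, transported along a bijection: pairs in different
blocks are colored by `c₁`, pairs inside a block by `c₂`. -/
def blowup [DecidableEq V] (e : V × W ≃ X) (c₁ : V → V → κ) (c₂ : W → W → κ) (x y : X) : κ :=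
  if (e.symm x).1 = (e.symm y).1 then c₂ (e.symm x).2 (e.symm y).2
  else c₁ (e.symm x).1 (e.symm y).1

theorem card_rainbowCopies_blowup [Fintype α] [Nontrivial α] [DecidableEq V] [Finite V] [Finite W]
    (e : V × W ≃ X) (c₁ : V → V → κ) (c₂ : W → W → κ) :
    Nat.card V * Nat.card (H.rainbowCopies c₂) +
        Nat.card W ^ Fintype.card α * Nat.card (H.rainbowCopies c₁) ≤
      Nat.card (H.rainbowCopies (blowup e c₁ c₂)) := by
  have : Finite X := Finite.of_equiv _ e
  choose F₁ hF₁ hr₁ using fun S : H.rainbowCopies c₁ => S.2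
  choose F₂ hF₂ hr₂ using fun S : H.rainbowCopies c₂ => S.2
  let A (x : V × H.rainbowCopies c₂) : α ↪ X :=
    ⟨fun i => e (x.1, F₂ x.2 i), fun i j h => by simpa using h⟩
  let B (x : (α → W) × H.rainbowCopies c₁) : α ↪ X :=
    ⟨fun i => e (F₁ x.2 i, x.1 i), fun i j h => by
      have := e.injective h
      exact (F₁ x.2).injective (congrArg Prod.fst this)⟩
  have hAe (x i) : e.symm (A x i) = (x.1, F₂ x.2 i) := e.symm_apply_apply _
  have hBe (x i) : e.symm (B x i) = (F₁ x.2 i, x.1 i) := e.symm_apply_apply _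
  have hA (x) : H.IsRainbow (blowup e c₁ c₂) (A x) := fun i j k l hij hkl h =>
    hr₂ x.2 i j k l hij hkl (by simpa [hAe, blowup] using h)
  have hB (x) : H.IsRainbow (blowup e c₁ c₂) (B x) := fun i j k l hij hkl h =>
    hr₁ x.2 i j k l hij hkl (by simpa [hBe, blowup, hij.ne, hkl.ne] using h)
  let Φ : (V × H.rainbowCopies c₂) ⊕ ((α → W) × H.rainbowCopies c₁) →
      H.rainbowCopies (blowup e c₁ c₂) :=
    Sum.elim (fun x => ⟨H.copyOf (A x), A x, rfl, hA x⟩) (fun x => ⟨H.copyOf (B x), B x, rfl, hB x⟩)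
  have hAB (x y) : H.copyOf (B x) ≠ H.copyOf (A y) := fun h => by
    obtain ⟨i, j, hij⟩ := exists_pair_ne α
    obtain ⟨i', hi⟩ := mem_range_of_copyOf_eq h i
    obtain ⟨j', hj⟩ := mem_range_of_copyOf_eq h j
    have hi := congrArg Prod.fst (e.injective hi)
    have hj := congrArg Prod.fst (e.injective hj)
    exact hij ((F₁ x.2).injective (hi.symm.trans hj))
  have hΦ : Function.Injective Φ := by
    rintro (⟨v, S⟩ | ⟨g, S⟩) (⟨v', S'⟩ | ⟨g', S'⟩) h <;> have h := congrArg Subtype.val h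
    · have h : H.copyOf (A (v, S)) = H.copyOf (A (v', S')) := h
      obtain ⟨i⟩ : Nonempty α := inferInstance
      obtain ⟨j, hj⟩ := mem_range_of_copyOf_eq h i
      have hv : v' = v := congrArg Prod.fst (e.injective hj)
      have hS : H.copyOf (F₂ S) = H.copyOf (F₂ S') :=
        copyOf_eq_of_comp_eq (fun x => (e.symm x).2) h (by simp [hAe]) (by simp [hAe])
      rw [hF₂, hF₂] at hS
      rw [hv, Subtype.ext hS]
    · exact (hAB _ _ h.symm).elim
    · exact (hAB _ _ h).elim
    · have h : H.copyOf (B (g, S)) = H.copyOf (B (g', S')) := h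
      have hS : H.copyOf (F₁ S) = H.copyOf (F₁ S') :=
        copyOf_eq_of_comp_eq (fun x => (e.symm x).1) h (by simp [hBe]) (by simp [hBe])
      rw [hF₁, hF₁] at hS
      obtain rfl := Subtype.ext hS
      have hg : g = g' := by
        funext i
        obtain ⟨j, hj⟩ := mem_range_of_copyOf_eq h i
        have hj := e.injective hj
        obtain rfl : j = i := (F₁ S).injective (congrArg Prod.fst hj)
        exact (congrArg Prod.snd hj).symm
      rw [hg]
  have key := Nat.card_le_card_of_injective Φ hΦ
  rwa [Nat.card_sum, Nat.card_prod, Nat.card_prod, Nat.card_fun, Nat.card_eq_fintype_card (α := α)]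
    at key

end SimpleGraph

lemma rainbowCount_eq_card_rainbowCopies {p n r : ℕ} (H : SimpleGraph (Fin p))
    (φ : KEdge n → Fin r) (c : Fin n → Fin n → Fin r) (hc : ∀ x y, c x y = c y x)
    (hφ : ∀ q : KEdge n, φ q = c q.1.1 q.1.2) :
    rainbowCount H φ = Nat.card (H.rainbowCopies c) := by
  refine Nat.card_congr (Equiv.subtypeEquivRight fun S => ⟨?_, ?_⟩)
  · rintro ⟨⟨f⟩, hS⟩
    have hadj {i j} : S.Adj (f i) (f j) ↔ H.Adj i j := f.map_rel_iff
    refine ⟨f.toEquiv.toEmbedding.trans (Function.Embedding.subtype _), ?_, ?_⟩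
    · apply SimpleGraph.Subgraph.ext
      · ext x
        constructor
        · rintro ⟨i, rfl⟩
          exact (f i).2
        · intro hx
          exact ⟨f.symm ⟨x, hx⟩, congrArg Subtype.val (f.apply_symm_apply ⟨x, hx⟩)⟩
      · ext x y
        constructor
        · rintro ⟨i, j, h, rfl, rfl⟩
          exact hadj.2 h
        · intro h
          obtain ⟨i, hi⟩ := f.surjective ⟨x, S.edge_vert h⟩
          obtain ⟨j, hj⟩ := f.surjective ⟨y, S.edge_vert h.symm⟩
          refine ⟨i, j, hadj.1 (by rwa [hi, hj]), congrArg Subtype.val hi, congrArg Subtype.val hj⟩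
    · have horient (i j : Fin p) (h : H.Adj i j) : ∃ q : KEdge n, S.Adj q.1.1 q.1.2 ∧
          φ q = c (f i) (f j) ∧ s(q.1.1, q.1.2) = s((f i : Fin n), (f j : Fin n)) := by
        have hne : (f i : Fin n) ≠ f j := (hadj.2 h).ne
        rcases hne.lt_or_gt with hlt | hlt
        · exact ⟨⟨(f i, f j), hlt⟩, hadj.2 h, hφ _, rfl⟩
        · exact ⟨⟨(f j, f i), hlt⟩, hadj.2 h.symm, (hφ _).trans (hc _ _), Sym2.eq_swap⟩
      intro i j k l hij hkl h
      obtain ⟨q, hq, hqc, hqs⟩ := horient i j hij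
      obtain ⟨q', hq', hqc', hqs'⟩ := horient k l hkl
      have hqq : q = q' := hS hq hq' (by rw [hqc, hqc']; exact h)
      rw [← hqq, hqs] at hqs'
      exact Sym2.map.injective (f := fun i => (f i : Fin n))
        (Subtype.val_injective.comp f.injective) hqs'
  · rintro ⟨F, rfl, hF⟩
    refine ⟨⟨⟨Equiv.ofInjective F F.injective, ?_⟩⟩, ?_⟩
    · exact fun {a b} => Relation.map_apply_apply F.injective F.injective H.Adj a b
    · rintro ⟨⟨x, y⟩, hxy⟩ ⟨i, j, hij, hi, hj⟩ ⟨⟨x', y'⟩, hxy'⟩ ⟨k, l, hkl, hk, hl⟩ h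
      rw [hφ, hφ] at h
      dsimp only at hi hj hk hl h hxy hxy'
      subst hi hj hk hl
      rcases Sym2.eq_iff.1 (hF i j k l hij hkl h) with ⟨rfl, rfl⟩ | ⟨rfl, rfl⟩
      · rfl
      · exact (lt_asymm hxy hxy').elim

lemma exists_symmetric_extension {n r : ℕ} (hr : 0 < r) (φ : KEdge n → Fin r) :
    ∃ c : Fin n → Fin n → Fin r, (∀ x y, c x y = c y x) ∧
      ∀ q : KEdge n, φ q = c q.1.1 q.1.2 := by
  refine ⟨fun x y => if h : x < y then φ ⟨(x, y), h⟩ else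
    if h : y < x then φ ⟨(y, x), h⟩ else ⟨0, hr⟩, fun x y => ?_, fun q => ?_⟩
  · rcases lt_trichotomy x y with h | rfl | h
    · simp [h, h.not_gt]
    · rfl
    · simp [h, h.not_gt]
  · simp [q.2]

/-- **Iterated blowup**: if `H` has at least two vertices, `r, m ≥ 2`, and some
`r`-coloring `φ` of `E(K_m)` has at least `ℓ` rainbow copies of `H`, then for every
positive integer `d` there is an `r`-coloring `ψ` of `E(K_{m^d})` with at least
`ℓ · (m^{d·v(H)} − m^d) / (m^{v(H)} − m)` rainbow copies of `H`. -/
theorem iterated_blowup {p : ℕ} (H : SimpleGraph (Fin p)) (hp : 2 ≤ p)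
    {r m : ℕ} (hr : 2 ≤ r) (hm : 2 ≤ m) (ℓ : ℕ) (φ : KEdge m → Fin r)
    (hφ : ℓ ≤ rainbowCount H φ) (d : ℕ) (hd : 0 < d) :
    ∃ ψ : KEdge (m ^ d) → Fin r,
      (ℓ : ℝ) * ((m : ℝ) ^ (d * p) - (m : ℝ) ^ d) / ((m : ℝ) ^ p - (m : ℝ)) ≤
        (rainbowCount H ψ : ℝ) := by
  obtain ⟨c, hc, hcφ⟩ := exists_symmetric_extension (by omega) φ
  rw [rainbowCount_eq_card_rainbowCopies H φ c hc hcφ] at hφ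
  have : Nontrivial (Fin p) := Fin.nontrivial_iff_two_le.2 hp
  have hm1 : (1 : ℝ) < m := by exact_mod_cast hm
  have hpos : (0 : ℝ) < (m : ℝ) ^ p - m := by
    have := pow_lt_pow_right₀ hm1 (show 1 < p by omega)
    rw [pow_one] at this
    linarith
  have key (k : ℕ) : ∃ b : Fin (m ^ k) → Fin (m ^ k) → Fin r, (∀ x y, b x y = b y x) ∧
      (ℓ : ℝ) * ((m : ℝ) ^ (k * p) - (m : ℝ) ^ k) ≤
        Nat.card (H.rainbowCopies b) * ((m : ℝ) ^ p - m) := by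
    induction k with
    | zero =>
      refine ⟨fun _ _ => ⟨0, by omega⟩, fun _ _ => rfl, ?_⟩
      simp only [zero_mul, pow_zero, sub_self, mul_zero]
      positivity
    | succ k ih =>
      obtain ⟨b, hb, hbl⟩ := ih
      let e : Fin (m ^ k) × Fin m ≃ Fin (m ^ (k + 1)) :=
        finProdFinEquiv.trans (finCongr (pow_succ m k).symm)
      refine ⟨SimpleGraph.blowup e b c, fun x y => ?_, ?_⟩
      · simp only [SimpleGraph.blowup, eq_comm, hb (e.symm x).1, hc (e.symm x).2]
      · have h := H.card_rainbowCopies_blowup e b c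
        rw [Nat.card_fin, Nat.card_fin, Fintype.card_fin] at h
        have h' : (m : ℝ) ^ k * ℓ + (m : ℝ) ^ p * Nat.card (H.rainbowCopies b) ≤
            Nat.card (H.rainbowCopies (SimpleGraph.blowup e b c)) := by
          exact_mod_cast (Nat.add_le_add_right (Nat.mul_le_mul_left _ hφ) _).trans h
        calc (ℓ : ℝ) * ((m : ℝ) ^ ((k + 1) * p) - (m : ℝ) ^ (k + 1))
            = (m : ℝ) ^ k * ℓ * ((m : ℝ) ^ p - m) +
                (m : ℝ) ^ p * (ℓ * ((m : ℝ) ^ (k * p) - (m : ℝ) ^ k)) := by ring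
          _ ≤ (m : ℝ) ^ k * ℓ * ((m : ℝ) ^ p - m) +
                (m : ℝ) ^ p * (Nat.card (H.rainbowCopies b) * ((m : ℝ) ^ p - m)) := by gcongr
          _ = ((m : ℝ) ^ k * ℓ + (m : ℝ) ^ p * Nat.card (H.rainbowCopies b)) *
                ((m : ℝ) ^ p - m) := by ring
          _ ≤ _ := mul_le_mul_of_nonneg_right h' hpos.le
  obtain ⟨b, hb, hbl⟩ := key d
  refine ⟨fun q => b q.1.1 q.1.2, ?_⟩
  rw [rainbowCount_eq_card_rainbowCopies H _ b hb fun _ => rfl, div_le_iff₀ hpos]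
  exact hbl
end

section
/- There exists a coloring φ: E(K_8) → {1,2,3,4,5} of the edges of the complete graph on 8 vertices such that at least 126 of the 5-cycles in K_8 are rainbow, i.e., have all five edges receiving pairwise distinct colors. -/
open Finset

/-- The coloring of pairs of vertices of `K_8` obtained by splitting the vertices into four
consecutive pairs: a pair of vertices gets a color depending only on the blocks of its members. -/
def blockColor (u v : Fin 8) : Fin 5 :=
  (![![0, 1, 2, 2],
     ![1, 0, 3, 3],
     ![2, 3, 0, 4],
     ![2, 3, 4, 0]] : Fin 4 → Fin 4 → Fin 5) (u.divNat (n := 2)) (v.divNat (n := 2))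

lemma blockColor_comm (u v : Fin 8) : blockColor u v = blockColor v u := by
  revert u v; decide

/-- The tuples `(a, b, c, d, e)` that traverse a rainbow `5`-cycle starting from its least vertex
towards the smaller of the two neighbors of that vertex. -/
def rainbowTuples : Finset (Fin 8 × Fin 8 × Fin 8 × Fin 8 × Fin 8) :=
  univ.filter fun (a, b, c, d, e) ↦
    (a < b ∧ b < e ∧ a < c ∧ a < d) ∧ [a, b, c, d, e].Nodup ∧
      [blockColor a b, blockColor b c, blockColor c d, blockColor d e, blockColor e a].Nodup

lemma mem_rainbowTuples {a b c d e : Fin 8} : (a, b, c, d, e) ∈ rainbowTuples ↔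
    (a < b ∧ b < e ∧ a < c ∧ a < d) ∧ [a, b, c, d, e].Nodup ∧
      [blockColor a b, blockColor b c, blockColor c d, blockColor d e, blockColor e a].Nodup := by
  simp only [rainbowTuples, mem_filter, mem_univ, true_and]

lemma card_rainbowTuples : #rainbowTuples = 128 := by
  decide +kernel

/-- Five distinct vertices of `K_n`, listed in cyclic order, span a copy of `C_5`. -/
lemma exists_subgraph_cycleGraph_five {n : ℕ} {a b c d e : Fin n} (h : [a, b, c, d, e].Nodup) :
    ∃ S : (⊤ : SimpleGraph (Fin n)).Subgraph, Nonempty (SimpleGraph.cycleGraph 5 ≃g S.coe) ∧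
      ∀ u v, S.Adj u v ↔ s(u, v) ∈ [s(a, b), s(b, c), s(c, d), s(d, e), s(e, a)] := by
  have hf : Function.Injective ![a, b, c, d, e] := List.nodup_ofFn.mp (by simpa using h)
  let f : SimpleGraph.Copy (SimpleGraph.cycleGraph 5) (⊤ : SimpleGraph (Fin n)) :=
    ⟨⟨![a, b, c, d, e], fun hij ↦ hf.ne hij.ne⟩, hf⟩
  refine ⟨f.toSubgraph, ⟨f.isoToSubgraph⟩, fun u v ↦ ?_⟩
  have hadj : f.toSubgraph.Adj u v ↔ ∃ i j, (SimpleGraph.cycleGraph 5).Adj i j ∧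
      ![a, b, c, d, e] i = u ∧ ![a, b, c, d, e] j = v := Iff.rfl
  rw [hadj]
  simp [Fin.exists_fin_succ, SimpleGraph.cycleGraph_adj]
  grind

/-- A `5`-cycle is traversed in a unique way from its least vertex towards the smaller of the two
neighbors of that vertex. -/
lemma five_cycle_traversal_unique {α : Type*} [LinearOrder α] {a b c d e a' b' c' d' e' : α}
    (hnd : [a, b, c, d, e].Nodup) (hnd' : [a', b', c', d', e'].Nodup)
    (hmin : a < b ∧ b < e ∧ a < c ∧ a < d) (hmin' : a' < b' ∧ b' < e' ∧ a' < c' ∧ a' < d')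
    (h : ∀ u v, s(u, v) ∈ [s(a, b), s(b, c), s(c, d), s(d, e), s(e, a)] ↔
      s(u, v) ∈ [s(a', b'), s(b', c'), s(c', d'), s(d', e'), s(e', a')]) :
    a = a' ∧ b = b' ∧ c = c' ∧ d = d' ∧ e = e' := by
  simp only [List.mem_cons, List.not_mem_nil, or_false, Sym2.eq_iff] at h
  have hab := h a b
  have hbc := h b c
  have hcd := h c d
  have hea := h e a
  have hab' := h a' b'
  have hbc' := h b' c'
  have hcd' := h c' d'
  have hea' := h e' a'
  clear h
  have ha : a = a' := by grind
  subst ha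
  have hb : b = b' := by grind
  subst hb
  have he : e = e' := by grind
  subst he
  have hc : c = c' := by grind
  subst hc
  grind

/-- A `5`-cycle whose consecutive colors under a symmetric function are distinct is rainbow. -/
lemma injOn_of_nodup_colors {n r : ℕ} {χ : Fin n → Fin n → Fin r} (hχ : ∀ u v, χ u v = χ v u)
    {a b c d e : Fin n} (h : [χ a b, χ b c, χ c d, χ d e, χ e a].Nodup) :
    Set.InjOn (fun q : KEdge n ↦ χ q.val.1 q.val.2)
      {q | s(q.val.1, q.val.2) ∈ [s(a, b), s(b, c), s(c, d), s(d, e), s(e, a)]} := by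
  have hinj : ∀ x ∈ [s(a, b), s(b, c), s(c, d), s(d, e), s(e, a)],
      ∀ y ∈ [s(a, b), s(b, c), s(c, d), s(d, e), s(e, a)],
      Sym2.lift ⟨χ, hχ⟩ x = Sym2.lift ⟨χ, hχ⟩ y → x = y :=
    fun _ hx _ hy hxy ↦
      List.inj_on_of_nodup_map (f := Sym2.lift ⟨χ, hχ⟩) (by simpa using h) hx hy hxy
  rintro ⟨⟨u, v⟩, huv⟩ hq ⟨⟨u', v'⟩, huv'⟩ hq' hcol
  have huv_eq := hinj _ hq _ hq' hcol
  rw [Sym2.eq_iff] at huv_eq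
  grind

/-- **There is a `5`-coloring of `E(K_8)` with at least `126` rainbow `5`-cycles.** -/
theorem exists_coloring_K8_rainbow_C5 :
    ∃ φ : KEdge 8 → Fin 5, 126 ≤ rainbowCount (SimpleGraph.cycleGraph 5) φ := by
  have hS : ∀ t : rainbowTuples, ∃ S : (⊤ : SimpleGraph (Fin 8)).Subgraph,
      Nonempty (SimpleGraph.cycleGraph 5 ≃g S.coe) ∧ ∀ u v, S.Adj u v ↔
        s(u, v) ∈ [s(t.1.1, t.1.2.1), s(t.1.2.1, t.1.2.2.1), s(t.1.2.2.1, t.1.2.2.2.1),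
          s(t.1.2.2.2.1, t.1.2.2.2.2), s(t.1.2.2.2.2, t.1.1)] :=
    fun t ↦ exists_subgraph_cycleGraph_five (mem_rainbowTuples.mp t.2).2.1
  choose S hiso hadj using hS
  refine ⟨fun q ↦ blockColor q.val.1 q.val.2, ?_⟩
  have hle : Nat.card rainbowTuples ≤
      rainbowCount (SimpleGraph.cycleGraph 5) fun q : KEdge 8 ↦ blockColor q.val.1 q.val.2 := by
    refine Nat.card_le_card_of_injective (fun t ↦ ⟨S t, hiso t, ?_⟩) ?_
    · simp only [hadj]
      exact injOn_of_nodup_colors blockColor_comm (mem_rainbowTuples.mp t.2).2.2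
    · intro t t' h
      have hSS : S t = S t' := congrArg Subtype.val h
      have huv := fun u v ↦ (hadj t u v).symm.trans (hSS ▸ hadj t' u v)
      obtain ⟨⟨a, b, c, d, e⟩, ht⟩ := t
      obtain ⟨⟨a', b', c', d', e'⟩, ht'⟩ := t'
      obtain ⟨rfl, rfl, rfl, rfl, rfl⟩ := five_cycle_traversal_unique
        (mem_rainbowTuples.mp ht).2.1 (mem_rainbowTuples.mp ht').2.1
        (mem_rainbowTuples.mp ht).1 (mem_rainbowTuples.mp ht').1 huv
      rfl
  rw [Nat.card_eq_fintype_card, Fintype.card_coe, card_rainbowTuples] at hle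
  lia
end

section
/- For s ∈ {4, 5}, the cycle graph C_s on s vertices is s-rainbow uncommon: limsup_{n→∞} (max over s-colorings φ of E(K_n) of the number of rainbow copies of C_s under φ)/n^{s} > s!/(s^{s}·2s). -/
open Finset

namespace RainbowCycle

/-- The image of `H` under a map of vertices, as a subgraph of the complete graph. -/
def imageSubgraph {p n : ℕ} (H : SimpleGraph (Fin p)) (g : Fin p ↪ Fin n) :
    (⊤ : SimpleGraph (Fin n)).Subgraph where
  verts := Set.range g
  Adj u v := ∃ a b, H.Adj a b ∧ g a = u ∧ g b = v
  adj_sub := by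
    rintro _ _ ⟨a, b, hab, rfl, rfl⟩
    simpa using hab.ne
  edge_vert := by
    rintro _ _ ⟨a, b, hab, rfl, rfl⟩
    exact ⟨a, rfl⟩
  symm := ⟨by
    rintro _ _ ⟨a, b, hab, rfl, rfl⟩
    exact ⟨b, a, hab.symm, rfl, rfl⟩⟩

/-- `H` is isomorphic to its image under an embedding. -/
noncomputable def isoImageSubgraph {p n : ℕ} (H : SimpleGraph (Fin p)) (g : Fin p ↪ Fin n) :
    H ≃g (imageSubgraph H g).coe where
  toEquiv := Equiv.ofInjective g g.injective
  map_rel_iff' := by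
    intro a b
    constructor
    · rintro ⟨a', b', hab, ha, hb⟩
      rwa [g.injective ha, g.injective hb] at hab
    · intro hab
      exact ⟨a, b, hab, rfl, rfl⟩

/-- An embedding is rainbow if the edges of the image of `H` have distinct colors. -/
def IsRainbow {p n r : ℕ} (H : SimpleGraph (Fin p)) (φ : KEdge n → Fin r)
    (g : Fin p ↪ Fin n) : Prop :=
  Set.InjOn φ {q : KEdge n | (imageSubgraph H g).Adj q.val.1 q.val.2}

theorem card_isRainbow_le {p n r : ℕ} (H : SimpleGraph (Fin p)) (φ : KEdge n → Fin r) :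
    Nat.card {g : Fin p ↪ Fin n // IsRainbow H φ g} ≤
      rainbowCount H φ *
        Nat.card {σ : Equiv.Perm (Fin p) // ∀ a b, H.Adj a b → H.Adj (σ a) (σ b)} := by
  classical
  rw [rainbowCount, ← Nat.card_prod]
  let T := {S : (⊤ : SimpleGraph (Fin n)).Subgraph //
    Nonempty (H ≃g S.coe) ∧ Set.InjOn φ {q : KEdge n | S.Adj q.val.1 q.val.2}}
  let ψ : ∀ S : T, H ≃g S.1.coe := fun S => S.2.1.some
  let toT : {g : Fin p ↪ Fin n // IsRainbow H φ g} → T :=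
    fun g => ⟨imageSubgraph H g.1, ⟨isoImageSubgraph H g.1⟩, g.2⟩
  let F : {g : Fin p ↪ Fin n // IsRainbow H φ g} →
      T × {σ : Equiv.Perm (Fin p) // ∀ a b, H.Adj a b → H.Adj (σ a) (σ b)} := fun g =>
    (toT g, ⟨((isoImageSubgraph H g.1).trans (ψ (toT g)).symm).toEquiv, fun a b hab =>
      ((isoImageSubgraph H g.1).trans (ψ (toT g)).symm).map_rel_iff.2 hab⟩)
  have key : ∀ g a, (g.1 a : Fin n) = (ψ (F g).1 ((F g).2.1 a) : Fin n) := by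
    intro g a
    change _ = ((ψ (toT g)) ((ψ (toT g)).symm (isoImageSubgraph H g.1 a))).1
    rw [RelIso.apply_symm_apply]
    rfl
  refine Nat.card_le_card_of_injective F fun g g' h => ?_
  ext a
  rw [key g a, key g' a, h]

theorem rainbowCount_le_pow {p n r : ℕ} (H : SimpleGraph (Fin p)) (φ : KEdge n → Fin r) :
    rainbowCount H φ ≤ n ^ p := by
  classical
  let T := {S : (⊤ : SimpleGraph (Fin n)).Subgraph //
    Nonempty (H ≃g S.coe) ∧ Set.InjOn φ {q : KEdge n | S.Adj q.val.1 q.val.2}}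
  let ψ : ∀ S : T, H ≃g S.1.coe := fun S => S.2.1.some
  have hverts : ∀ (S : T) (v : Fin n), v ∈ S.1.verts ↔ ∃ a, (ψ S a : Fin n) = v := by
    intro S v
    constructor
    · intro hv
      exact ⟨(ψ S).symm ⟨v, hv⟩, by simp⟩
    · rintro ⟨a, rfl⟩
      exact (ψ S a).2
  have hadj : ∀ (S : T) (u v : Fin n), S.1.Adj u v ↔
      ∃ a b, H.Adj a b ∧ (ψ S a : Fin n) = u ∧ (ψ S b : Fin n) = v := by
    intro S u v
    constructor
    · intro h
      refine ⟨(ψ S).symm ⟨u, S.1.edge_vert h⟩, (ψ S).symm ⟨v, S.1.edge_vert h.symm⟩, ?_,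
        by simp, by simp⟩
      exact (ψ S).symm.map_rel_iff.2 h
    · rintro ⟨a, b, hab, rfl, rfl⟩
      exact (ψ S).map_rel_iff.2 hab
  have hinj : Function.Injective (fun (S : T) (a : Fin p) => (ψ S a : Fin n)) := by
    intro S S' h
    have h' : ∀ a, (ψ S a : Fin n) = ψ S' a := congrFun h
    apply Subtype.ext
    apply SimpleGraph.Subgraph.ext
    · ext v
      simp only [hverts, h']
    · ext u v
      simp only [hadj, h']
  calc rainbowCount H φ = Nat.card T := rfl
    _ ≤ Nat.card (Fin p → Fin n) := Nat.card_le_card_of_injective _ hinj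
    _ = n ^ p := by simp

/-- The injective closed walks of length `s + 1` whose edges have distinct colors under `c`. -/
abbrev RainbowWalk {k s r : ℕ} (c : Fin k → Fin k → Fin r) : Type :=
  {f : Fin (s + 1) → Fin k // Function.Injective f ∧
    Function.Injective fun i => c (f i) (f (i + 1))}

theorem card_rainbowWalk_mul_pow_le {k s r : ℕ} (c : Fin k → Fin k → Fin r)
    (hc : ∀ i j, c i j = c j i) (m : ℕ) : ∃ φ : KEdge (k * m) → Fin r,
    Nat.card (RainbowWalk (s := s) c) * m ^ (s + 1) ≤
      Nat.card {g : Fin (s + 1) ↪ Fin (k * m) //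
        IsRainbow (SimpleGraph.cycleGraph (s + 1)) φ g} := by
  let e : Fin k × Fin m ≃ Fin (k * m) := finProdFinEquiv
  let φ : KEdge (k * m) → Fin r := fun q => c (e.symm q.1.1).1 (e.symm q.1.2).1
  refine ⟨φ, ?_⟩
  let F : RainbowWalk (s := s) c × (Fin (s + 1) → Fin m) →
      {g : Fin (s + 1) ↪ Fin (k * m) //
        IsRainbow (SimpleGraph.cycleGraph (s + 1)) φ g} := fun x =>
    ⟨⟨fun i => e (x.1.1 i, x.2 i), fun i j h => x.1.2.1 (congrArg Prod.fst (e.injective h))⟩, by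
      have hedge : ∀ q : KEdge (k * m), (imageSubgraph (SimpleGraph.cycleGraph (s + 1))
          ⟨fun i => e (x.1.1 i, x.2 i), fun i j h =>
            x.1.2.1 (congrArg Prod.fst (e.injective h))⟩).Adj q.val.1 q.val.2 →
          ∃ i, φ q = c (x.1.1 i) (x.1.1 (i + 1)) ∧
            s(q.val.1, q.val.2) = s(e (x.1.1 i, x.2 i), e (x.1.1 (i + 1), x.2 (i + 1))) := by
        rintro ⟨⟨u, v⟩, huv⟩ ⟨a, b, hab, ha, hb⟩
        dsimp only [Function.Embedding.coeFn_mk] at ha hb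
        have hq : φ ⟨(u, v), huv⟩ = c (x.1.1 a) (x.1.1 b) := by
          change c (e.symm u).1 (e.symm v).1 = _
          rw [show u = e (x.1.1 a, x.2 a) from ha.symm, show v = e (x.1.1 b, x.2 b) from hb.symm,
            Equiv.symm_apply_apply, Equiv.symm_apply_apply]
        have h : b = a + 1 ∨ a = b + 1 := by
          cases s with
          | zero => exact absurd (Subsingleton.elim (α := Fin 1) a b) hab.ne
          | succ s =>
            rw [SimpleGraph.cycleGraph_adj] at hab
            rcases hab with h | h
            · exact Or.inr (by rw [← h]; abel)
            · exact Or.inl (by rw [← h]; abel)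
        rcases h with rfl | rfl
        · exact ⟨a, hq, Sym2.eq_iff.2 (Or.inl ⟨ha.symm, hb.symm⟩)⟩
        · exact ⟨b, hq.trans (hc _ _), Sym2.eq_iff.2 (Or.inr ⟨ha.symm, hb.symm⟩)⟩
      intro q hq q' hq' h
      obtain ⟨i, hi, hi'⟩ := hedge q hq
      obtain ⟨j, hj, hj'⟩ := hedge q' hq'
      have hij : i = j := x.1.2.2 (hi.symm.trans (h.trans hj))
      subst hij
      have hs := hi'.trans hj'.symm
      have hlt := q.2
      have hlt' := q'.2
      rw [Sym2.eq_iff] at hs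
      rcases hs with ⟨h1, h2⟩ | ⟨h1, h2⟩
      · exact Subtype.ext (Prod.ext h1 h2)
      · rw [h1, h2] at hlt
        exact absurd hlt hlt'.asymm⟩
  have hF : Function.Injective F := by
    intro x y h
    have h' : ∀ i, (x.1.1 i, x.2 i) = (y.1.1 i, y.2 i) := fun i =>
      e.injective (DFunLike.congr_fun (congrArg Subtype.val h) i)
    refine Prod.ext (Subtype.ext (funext fun i => ?_)) (funext fun i => ?_)
    · exact congrArg Prod.fst (h' i)
    · exact congrArg Prod.snd (h' i)
  simpa using Nat.card_le_card_of_injective F hF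

theorem lt_limsup_of_rainbowWalk {k s A : ℕ} (hk : 0 < k) (hA : 0 < A)
    (c : Fin k → Fin k → Fin (s + 1)) (hc : ∀ i j, c i j = c j i)
    (hAut : Nat.card {σ : Equiv.Perm (Fin (s + 1)) // ∀ a b,
      (SimpleGraph.cycleGraph (s + 1)).Adj a b →
      (SimpleGraph.cycleGraph (s + 1)).Adj (σ a) (σ b)} ≤ A)
    {t : ℝ} (ht : t < Nat.card (RainbowWalk (s := s) c) / ((k : ℝ) ^ (s + 1) * A)) :
    t < Filter.atTop.limsup (fun n : ℕ =>
      (⨆ φ : KEdge n → Fin (s + 1),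
        (rainbowCount (SimpleGraph.cycleGraph (s + 1)) φ : ℝ)) / (n : ℝ) ^ (s + 1)) := by
  refine ht.trans_le (Filter.le_limsup_of_frequently_le ?_ ?_)
  · rw [Filter.frequently_atTop]
    intro N
    refine ⟨k * (N + 1), by nlinarith, ?_⟩
    obtain ⟨φ, hφ⟩ := card_rainbowWalk_mul_pow_le (s := s) c hc (N + 1)
    have h1 := hφ.trans ((card_isRainbow_le _ φ).trans (Nat.mul_le_mul_left _ hAut))
    have h2 : (Nat.card (RainbowWalk (s := s) c) : ℝ) * ((N + 1 : ℕ) : ℝ) ^ (s + 1) ≤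
        rainbowCount (SimpleGraph.cycleGraph (s + 1)) φ * A := by exact_mod_cast h1
    have h3 : (rainbowCount (SimpleGraph.cycleGraph (s + 1)) φ : ℝ) ≤
        ⨆ φ : KEdge (k * (N + 1)) → Fin (s + 1),
          (rainbowCount (SimpleGraph.cycleGraph (s + 1)) φ : ℝ) :=
      le_ciSup (f := fun φ : KEdge (k * (N + 1)) → Fin (s + 1) =>
        (rainbowCount (SimpleGraph.cycleGraph (s + 1)) φ : ℝ)) (Set.finite_range _).bddAbove φ
    have hk' : (0 : ℝ) < k := by exact_mod_cast hk
    have hA' : (0 : ℝ) < A := by exact_mod_cast hA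
    have hN : (0 : ℝ) < ((N + 1 : ℕ) : ℝ) := by positivity
    rw [Nat.cast_mul, div_le_div_iff₀ (by positivity) (by positivity), mul_pow]
    calc _ = (Nat.card (RainbowWalk (s := s) c) * ((N + 1 : ℕ) : ℝ) ^ (s + 1)) *
          (k : ℝ) ^ (s + 1) := by ring
      _ ≤ (rainbowCount (SimpleGraph.cycleGraph (s + 1)) φ * A) * (k : ℝ) ^ (s + 1) := by gcongr
      _ ≤ _ := by
        rw [mul_assoc, mul_comm (A : ℝ)]
        gcongr
  · refine Filter.isBoundedUnder_of ⟨1, fun n => ?_⟩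
    refine div_le_one_of_le₀ (Real.iSup_le (fun φ => ?_) (by positivity)) (by positivity)
    exact_mod_cast rainbowCount_le_pow _ φ

/-- A coloring of `K_5` by four colors with eight rainbow four-cycles. -/
def fourColoring : Fin 5 → Fin 5 → Fin 4 :=
  ![![0, 1, 0, 3, 1],
    ![1, 0, 2, 1, 3],
    ![0, 2, 0, 0, 2],
    ![3, 1, 0, 0, 1],
    ![1, 3, 2, 1, 0]]

/-- A coloring of `K_8` by five colors with 128 rainbow five-cycles. -/
def fiveColoring : Fin 8 → Fin 8 → Fin 5 :=
  ![![0, 0, 3, 3, 3, 1, 1, 3],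
    ![0, 0, 3, 3, 3, 1, 1, 3],
    ![3, 3, 0, 0, 4, 2, 2, 4],
    ![3, 3, 0, 0, 4, 2, 2, 0],
    ![3, 3, 4, 4, 0, 2, 2, 0],
    ![1, 1, 2, 2, 2, 0, 4, 2],
    ![1, 1, 2, 2, 2, 4, 0, 2],
    ![3, 3, 4, 0, 0, 2, 2, 0]]

theorem card_rainbowWalk_fourColoring :
    Nat.card (RainbowWalk (s := 3) fourColoring) = 64 := by
  rw [Nat.card_eq_fintype_card]
  decide +kernel

theorem sum_fin_succ_arrow {α M : Type*} [Fintype α] [AddCommMonoid M] {n : ℕ}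
    (F : (Fin (n + 1) → α) → M) :
    ∑ f, F f = ∑ a, ∑ f : Fin n → α, F (Fin.cons a f) := by
  rw [← (Fin.consEquiv fun _ : Fin (n + 1) => α).sum_comp, Fintype.sum_prod_type]
  rfl

/-- The number of rainbow five-cycles with a marked start and direction, computed by extending
rainbow paths one vertex at a time. -/
def fiveWalkCount {k r : ℕ} (c : Fin k → Fin k → Fin r) : ℕ :=
  ∑ v₀, ∑ v₁, if v₁ ≠ v₀ then
    ∑ v₂, if v₂ ≠ v₀ ∧ v₂ ≠ v₁ ∧ c v₁ v₂ ≠ c v₀ v₁ then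
      ∑ v₃, if v₃ ≠ v₀ ∧ v₃ ≠ v₁ ∧ v₃ ≠ v₂ ∧ c v₂ v₃ ≠ c v₀ v₁ ∧ c v₂ v₃ ≠ c v₁ v₂ then
        ∑ v₄, if v₄ ≠ v₀ ∧ v₄ ≠ v₁ ∧ v₄ ≠ v₂ ∧ v₄ ≠ v₃ ∧
            c v₃ v₄ ≠ c v₀ v₁ ∧ c v₃ v₄ ≠ c v₁ v₂ ∧ c v₃ v₄ ≠ c v₂ v₃ ∧
            c v₄ v₀ ≠ c v₀ v₁ ∧ c v₄ v₀ ≠ c v₁ v₂ ∧ c v₄ v₀ ≠ c v₂ v₃ ∧ c v₄ v₀ ≠ c v₃ v₄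
          then 1 else 0
      else 0
    else 0
  else 0

theorem fiveWalkCount_le {k r : ℕ} (c : Fin k → Fin k → Fin r) :
    fiveWalkCount c ≤ Nat.card (RainbowWalk (s := 4) c) := by
  classical
  rw [Nat.card_eq_fintype_card, Fintype.card_subtype, Finset.card_filter]
  simp only [sum_fin_succ_arrow, Fintype.sum_unique]
  refine Finset.sum_le_sum fun v₀ _ => Finset.sum_le_sum fun v₁ _ => ?_
  split_ifs with h₁
  swap
  · exact Nat.zero_le _
  refine Finset.sum_le_sum fun v₂ _ => ?_
  split_ifs with h₂
  swap
  · exact Nat.zero_le _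
  refine Finset.sum_le_sum fun v₃ _ => ?_
  split_ifs with h₃
  swap
  · exact Nat.zero_le _
  refine Finset.sum_le_sum fun v₄ _ => ?_
  split_ifs with h₄ h₅
  · exact le_rfl
  · refine absurd ⟨?_, ?_⟩ h₅
    · change Function.Injective ![v₀, v₁, v₂, v₃, v₄]
      intro i j
      fin_cases i <;> fin_cases j <;> simp <;> grind
    · have h : (fun i : Fin 5 => c (![v₀, v₁, v₂, v₃, v₄] i) (![v₀, v₁, v₂, v₃, v₄] (i + 1))) =
          ![c v₀ v₁, c v₁ v₂, c v₂ v₃, c v₃ v₄, c v₄ v₀] := by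
        funext i
        fin_cases i <;> rfl
      change Function.Injective
        (fun i : Fin 5 => c (![v₀, v₁, v₂, v₃, v₄] i) (![v₀, v₁, v₂, v₃, v₄] (i + 1)))
      rw [h]
      intro i j
      fin_cases i <;> fin_cases j <;> simp <;> grind
  · exact Nat.zero_le _
  · exact le_rfl

theorem le_card_rainbowWalk_fiveColoring :
    1280 ≤ Nat.card (RainbowWalk (s := 4) fiveColoring) := by
  refine le_trans (Eq.ge ?_) (fiveWalkCount_le _)
  decide +kernel

theorem card_cycleGraph_four_aut : Nat.card {σ : Equiv.Perm (Fin 4) // ∀ a b,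
    (SimpleGraph.cycleGraph 4).Adj a b → (SimpleGraph.cycleGraph 4).Adj (σ a) (σ b)} = 8 := by
  rw [Nat.card_eq_fintype_card]
  decide +kernel

theorem card_cycleGraph_five_aut : Nat.card {σ : Equiv.Perm (Fin 5) // ∀ a b,
    (SimpleGraph.cycleGraph 5).Adj a b → (SimpleGraph.cycleGraph 5).Adj (σ a) (σ b)} = 10 := by
  rw [Nat.card_eq_fintype_card]
  decide +kernel

end RainbowCycle

/-- **For `s ∈ {4, 5}`, the cycle `C_s` is `s`-rainbow uncommon**: the limsup over `n`
of (the maximum over `s`-colorings `φ` of `E(K_n)` of the number of rainbow copies of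
`C_s` under `φ`) divided by `n ^ s` strictly exceeds `s! / (s^s · 2s)`. -/
theorem cycle_four_five_rainbow_uncommon (s : ℕ) (hs : s = 4 ∨ s = 5) :
    (s.factorial : ℝ) / ((s : ℝ) ^ s * (2 * s)) <
      Filter.atTop.limsup (fun n : ℕ =>
        (⨆ φ : KEdge n → Fin s, (rainbowCount (SimpleGraph.cycleGraph s) φ : ℝ)) /
          (n : ℝ) ^ s) := by
  rcases hs with rfl | rfl
  · refine RainbowCycle.lt_limsup_of_rainbowWalk (s := 3) (A := 8) (by norm_num) (by norm_num)
      RainbowCycle.fourColoring (by decide) RainbowCycle.card_cycleGraph_four_aut.le ?_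
    rw [RainbowCycle.card_rainbowWalk_fourColoring]
    norm_num [Nat.factorial]
  · refine RainbowCycle.lt_limsup_of_rainbowWalk (s := 4) (A := 10) (by norm_num) (by norm_num)
      RainbowCycle.fiveColoring (by decide) RainbowCycle.card_cycleGraph_five_aut.le ?_
    have h : (1280 : ℝ) ≤ Nat.card (RainbowCycle.RainbowWalk (s := 4) RainbowCycle.fiveColoring) :=
      mod_cast RainbowCycle.le_card_rainbowWalk_fiveColoring
    refine lt_of_lt_of_le ?_ (div_le_div_of_nonneg_right h (by positivity))
    norm_num [Nat.factorial]
end
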